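/- Let $M_0 \subseteq \mathbb{Z}^n$ be a subgroup of finite index and let $Z$ be an $n\times n$ positive definite real symmetric matrix. Then for every $\tau \ge 1$ there exists $\varepsilon > 0$ such that for all $\tau' \ge 1$ with $|\tau' - \tau| < \varepsilon$, the set of minimal vectors at temperament $\tau'$ is contained in the set of minimal vectors at temperament $\tau$: $M_{\tau'}(Z) \subseteq M_\tau(Z)$. -/

import Mathlib

open Matrix
open scoped Classical

/-- The weighted quadratic form `φ_τ(x) Z[x]` with weight `1` on `M0` and `τ²` off `M0`. -/
noncomputable def weightedForm {n : ℕ} (M0 : AddSubgroup (Fin n → ℤ)) (τ : ℝ)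
    (Z : Matrix (Fin n) (Fin n) ℝ) (x : Fin n → ℤ) : ℝ :=
  (if x ∈ M0 then (1 : ℝ) else τ ^ 2) *
    (Matrix.vecMul (fun i => (x i : ℝ)) Z ⬝ᵥ fun i => (x i : ℝ))

/-- `m_τ(Z)`, the arithmetic minimum at temperament `τ`. -/
noncomputable def arithMin {n : ℕ} (M0 : AddSubgroup (Fin n → ℤ)) (τ : ℝ)
    (Z : Matrix (Fin n) (Fin n) ℝ) : ℝ :=
  sInf {r : ℝ | ∃ x : Fin n → ℤ, x ≠ 0 ∧ r = weightedForm M0 τ Z x}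

/-- `M_τ(Z)`, the set of minimal vectors at temperament `τ`. -/
noncomputable def minVecs {n : ℕ} (M0 : AddSubgroup (Fin n → ℤ)) (τ : ℝ)
    (Z : Matrix (Fin n) (Fin n) ℝ) : Set (Fin n → ℤ) :=
  {x : Fin n → ℤ | x ≠ 0 ∧ weightedForm M0 τ Z x = arithMin M0 τ Z}

/-- A positive definite form dominates a positive multiple of the squared sup norm. -/
theorem exists_pos_mul_sq_norm_le_form {n : ℕ} (Z : Matrix (Fin n) (Fin n) ℝ)
    (hZpd : ∀ v : Fin n → ℝ, v ≠ 0 → 0 < Matrix.vecMul v Z ⬝ᵥ v) :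
    ∃ c > 0, ∀ v : Fin n → ℝ, c * ‖v‖ ^ 2 ≤ Matrix.vecMul v Z ⬝ᵥ v := by
  have hcont : Continuous fun v : Fin n → ℝ => Matrix.vecMul v Z ⬝ᵥ v := by fun_prop
  obtain ⟨c, hc, hle⟩ := (isCompact_sphere (0 : Fin n → ℝ) 1).exists_forall_le' (a := 0)
    hcont.continuousOn fun v hv => hZpd v (ne_zero_of_mem_unit_sphere ⟨v, hv⟩)
  refine ⟨c, hc, fun v => ?_⟩
  rcases eq_or_ne v 0 with rfl | hv
  · simp
  have hnorm : ‖v‖ ≠ 0 := norm_ne_zero_iff.mpr hv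
  have h := hle (‖v‖⁻¹ • v) (by simp [norm_smul, hnorm])
  rw [Matrix.smul_vecMul, smul_dotProduct, dotProduct_smul, smul_eq_mul, smul_eq_mul] at h
  calc c * ‖v‖ ^ 2 ≤ (‖v‖⁻¹ * (‖v‖⁻¹ * (Matrix.vecMul v Z ⬝ᵥ v))) * ‖v‖ ^ 2 := by gcongr
    _ = Matrix.vecMul v Z ⬝ᵥ v := by field_simp

/-- Sublevel sets of a positive definite form contain finitely many integer vectors. -/
theorem finite_int_form_le {n : ℕ} (Z : Matrix (Fin n) (Fin n) ℝ)
    (hZpd : ∀ v : Fin n → ℝ, v ≠ 0 → 0 < Matrix.vecMul v Z ⬝ᵥ v) (C : ℝ) :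
    {x : Fin n → ℤ |
      (Matrix.vecMul (fun i => (x i : ℝ)) Z ⬝ᵥ fun i => (x i : ℝ)) ≤ C}.Finite := by
  obtain ⟨c, hc, hle⟩ := exists_pos_mul_sq_norm_le_form Z hZpd
  refine (isCompact_closedBall (0 : Fin n → ℤ) (Real.sqrt (C / c))).finite_of_discrete.subset ?_
  intro x hx
  rw [mem_closedBall_zero_iff, pi_norm_le_iff_of_nonneg (Real.sqrt_nonneg _)]
  intro i
  have hi : ‖x i‖ ≤ ‖fun i => (x i : ℝ)‖ := by
    simpa [Int.norm_eq_abs] using norm_le_pi_norm (fun i => (x i : ℝ)) i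
  refine hi.trans (Real.le_sqrt_of_sq_le ?_)
  rw [le_div_iff₀ hc, mul_comm]
  exact (hle _).trans hx

theorem form_nonneg {n : ℕ} {Z : Matrix (Fin n) (Fin n) ℝ}
    (hZpd : ∀ v : Fin n → ℝ, v ≠ 0 → 0 < Matrix.vecMul v Z ⬝ᵥ v) (v : Fin n → ℝ) :
    0 ≤ Matrix.vecMul v Z ⬝ᵥ v := by
  rcases eq_or_ne v 0 with rfl | hv
  · simp
  · exact (hZpd v hv).le

theorem continuous_weightedForm {n : ℕ} (M0 : AddSubgroup (Fin n → ℤ))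
    (Z : Matrix (Fin n) (Fin n) ℝ) (x : Fin n → ℤ) :
    Continuous fun τ => weightedForm M0 τ Z x := by
  unfold weightedForm
  split_ifs <;> fun_prop

theorem form_le_weightedForm {n : ℕ} (M0 : AddSubgroup (Fin n → ℤ))
    {Z : Matrix (Fin n) (Fin n) ℝ}
    (hZpd : ∀ v : Fin n → ℝ, v ≠ 0 → 0 < Matrix.vecMul v Z ⬝ᵥ v) {τ : ℝ} (hτ : 1 ≤ τ)
    (x : Fin n → ℤ) :
    (Matrix.vecMul (fun i => (x i : ℝ)) Z ⬝ᵥ fun i => (x i : ℝ)) ≤ weightedForm M0 τ Z x := by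
  unfold weightedForm
  refine le_mul_of_one_le_left (form_nonneg hZpd _) ?_
  split_ifs
  · exact le_rfl
  · exact one_le_pow₀ hτ

theorem bddBelow_weightedForm {n : ℕ} (M0 : AddSubgroup (Fin n → ℤ)) (τ : ℝ)
    {Z : Matrix (Fin n) (Fin n) ℝ}
    (hZpd : ∀ v : Fin n → ℝ, v ≠ 0 → 0 < Matrix.vecMul v Z ⬝ᵥ v) :
    BddBelow {r : ℝ | ∃ x : Fin n → ℤ, x ≠ 0 ∧ r = weightedForm M0 τ Z x} := by
  refine ⟨0, ?_⟩
  rintro _ ⟨x, -, rfl⟩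
  unfold weightedForm
  refine mul_nonneg ?_ (form_nonneg hZpd _)
  split_ifs <;> positivity

/-- Minimal vectors are the nonzero vectors at which the weighted form is least. -/
theorem mem_minVecs_iff {n : ℕ} (M0 : AddSubgroup (Fin n → ℤ)) (τ : ℝ)
    {Z : Matrix (Fin n) (Fin n) ℝ}
    (hZpd : ∀ v : Fin n → ℝ, v ≠ 0 → 0 < Matrix.vecMul v Z ⬝ᵥ v) (x : Fin n → ℤ) :
    x ∈ minVecs M0 τ Z ↔
      x ≠ 0 ∧ ∀ y : Fin n → ℤ, y ≠ 0 → weightedForm M0 τ Z x ≤ weightedForm M0 τ Z y := by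
  have hbdd := bddBelow_weightedForm M0 τ hZpd
  refine and_congr_right fun hx => ⟨fun h y hy => ?_, fun h => ?_⟩
  · rw [h]
    exact csInf_le hbdd ⟨y, hy, rfl⟩
  · refine le_antisymm (le_csInf ⟨_, x, hx, rfl⟩ ?_) (csInf_le hbdd ⟨x, hx, rfl⟩)
    rintro _ ⟨y, hy, rfl⟩
    exact h y hy

theorem stmt14 {n : ℕ} (M0 : AddSubgroup (Fin n → ℤ)) (hM0 : M0.index ≠ 0)
    (Z : Matrix (Fin n) (Fin n) ℝ) (hZsym : Z.IsSymm)
    (hZpd : ∀ v : Fin n → ℝ, v ≠ 0 → 0 < Matrix.vecMul v Z ⬝ᵥ v) :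
    ∀ τ : ℝ, 1 ≤ τ → ∃ ε > 0, ∀ τ' : ℝ, 1 ≤ τ' → |τ' - τ| < ε →
      minVecs M0 τ' Z ⊆ minVecs M0 τ Z := by
  intro τ _
  by_cases hne : ∃ y : Fin n → ℤ, y ≠ 0
  swap
  · exact ⟨1, one_pos, fun τ' _ _ x hx => (hne ⟨x, hx.1⟩).elim⟩
  obtain ⟨y, hy⟩ := hne
  have hbound : ∀ᶠ τ' in nhds τ, weightedForm M0 τ' Z y < weightedForm M0 τ Z y + 1 :=
    (continuous_weightedForm M0 Z y).continuousAt.eventually_lt continuousAt_const (lt_add_one _)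
  have hexcl : ∀ᶠ τ' in nhds τ, ∀ x ∈ {x : Fin n → ℤ |
      (Matrix.vecMul (fun i => (x i : ℝ)) Z ⬝ᵥ fun i => (x i : ℝ)) ≤
        weightedForm M0 τ Z y + 1}, x ∈ minVecs M0 τ' Z → x ∈ minVecs M0 τ Z := by
    refine (Filter.eventually_all_finite (finite_int_form_le Z hZpd _)).mpr fun x _ => ?_
    by_cases hx : x ∈ minVecs M0 τ Z
    · exact Filter.Eventually.of_forall fun _ _ => hx
    rcases eq_or_ne x 0 with rfl | hx0
    · exact Filter.Eventually.of_forall fun _ h => (h.1 rfl).elim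
    rw [mem_minVecs_iff M0 τ hZpd] at hx
    push Not at hx
    obtain ⟨z, hz, hlt⟩ := hx hx0
    filter_upwards [(continuous_weightedForm M0 Z z).continuousAt.eventually_lt
      (continuous_weightedForm M0 Z x).continuousAt hlt] with τ' hτ' hmem
    exact absurd (((mem_minVecs_iff M0 τ' hZpd x).mp hmem).2 z hz) hτ'.not_ge
  obtain ⟨ε, hε, h⟩ := Metric.eventually_nhds_iff.mp (hbound.and hexcl)
  refine ⟨ε, hε, fun τ' hτ' hdist x hx => ?_⟩
  obtain ⟨hlt, hsub⟩ := h (y := τ') (by rwa [Real.dist_eq])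
  refine hsub x ?_ hx
  exact (form_le_weightedForm M0 hZpd hτ' x).trans
    ((((mem_minVecs_iff M0 τ' hZpd x).mp hx).2 y hy).trans hlt.le)
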